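/- Let φ ∈ Φ and α > 0. Let {K_w}_{w>0} satisfy conditions (K_w.1) and (K_w.2), be an α-singular kernel, and assume there exists δ̃ ∈ (0,1) such that ∫_{|1−t|≤δ̃} |K_w(t)| |log t|^α ⟨t⟩^{−1} dt = O(w^{−α}) as w → +∞. Then for every f ∈ V^φ Lip_N(α) in the domain of the operators T_w there exists λ > 0 such that V^φ[λ(T_w f − f)] = O(w^{−α}) for sufficiently large w > 0, i.e., there exist C > 0 and w_0 > 0 with V^φ[λ(T_w f − f)] ≤ C w^{−α} for all w ≥ w_0. -/

import Mathlib

open MeasureTheory Filter Set Asymptotics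
open scoped ENNReal

noncomputable section

/-- The class `Φ`: `φ : [0,∞) → [0,∞)` convex, vanishing exactly at `0`,
with `φ(u)/u → 0` as `u → 0⁺`. -/
def IsPhiFun (φ : ℝ → ℝ) : Prop :=
  ConvexOn ℝ (Set.Ici 0) φ ∧ (∀ u, 0 ≤ u → 0 ≤ φ u) ∧
  (∀ u, 0 ≤ u → (φ u = 0 ↔ u = 0)) ∧
  Tendsto (fun u => φ u / u) (nhdsWithin 0 (Set.Ioi 0)) (nhds 0)

/-- The positive orthant `ℝ^N_+ = (0,∞)^N`. -/
def RPos (N : ℕ) : Set (Fin N → ℝ) := {x | ∀ i, 0 < x i}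

/-- `⟨t⟩ := ∏ᵢ tᵢ`. -/
def prodCoord {N : ℕ} (t : Fin N → ℝ) : ℝ := ∏ i, t i

/-- Euclidean distance `|1 - t|`. -/
def distOne {N : ℕ} (t : Fin N → ℝ) : ℝ := Real.sqrt (∑ i, (1 - t i) ^ 2)

/-- Euclidean norm `|log t|` of `log t := (log t₁, …, log t_N)`. -/
def logNorm {N : ℕ} (t : Fin N → ℝ) : ℝ := Real.sqrt (∑ i, Real.log (t i) ^ 2)

/-- `t^w := (t₁^w, …, t_N^w)`. -/
def powVec {N : ℕ} (t : Fin N → ℝ) (w : ℝ) : Fin N → ℝ := fun i => t i ^ w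

/-- The (Musielak–Orlicz) `φ`-variation of `g` on `[a,b]`:
`sup_D ∑ᵢ φ(|g(sᵢ) - g(sᵢ₋₁)|)` over all partitions `D` of `[a,b]`. -/
def phiVar1 (φ : ℝ → ℝ) (a b : ℝ) (g : ℝ → ℝ) : ℝ≥0∞ :=
  ⨆ (n : ℕ) (u : Fin (n + 1) → ℝ) (_ : Monotone u) (_ : u 0 = a) (_ : u (Fin.last n) = b),
    ∑ i : Fin n, ENNReal.ofReal (φ |g (u i.succ) - g (u i.castSucc)|)

/-- The point of `ℝ^N` obtained from `x'` (coordinates `≠ j`) by inserting `s`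
at the `j`-th coordinate. -/
def insertCoord {N : ℕ} (j : Fin N) (x' : {i : Fin N // i ≠ j} → ℝ) (s : ℝ) :
    Fin N → ℝ :=
  fun i => if h : i = j then s else x' ⟨i, h⟩

/-- `Φ^φ_j(f, I)`: the integral over `I'_j` (with weight `⟨x'_j⟩⁻¹`) of the `φ`-variations
of the `j`-th sections of `f`, where `I = ∏ᵢ [aᵢ, bᵢ]`. -/
def secVar {N : ℕ} (φ : ℝ → ℝ) (f : (Fin N → ℝ) → ℝ) (a b : Fin N → ℝ) (j : Fin N) :
    ℝ≥0∞ :=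
  ∫⁻ x' in Set.pi Set.univ (fun i : {i : Fin N // i ≠ j} => Set.Icc (a i.1) (b i.1)),
    phiVar1 φ (a j) (b j) (fun s => f (insertCoord j x' s)) *
      ENNReal.ofReal ((∏ i : {i : Fin N // i ≠ j}, x' i)⁻¹)

/-- `Φ^φ(f, I) := (∑_j Φ^φ_j(f,I)²)^{1/2}`. -/
def boxPhi {N : ℕ} (φ : ℝ → ℝ) (f : (Fin N → ℝ) → ℝ) (a b : Fin N → ℝ) : ℝ≥0∞ :=
  (∑ j : Fin N, secVar φ f a b j ^ 2) ^ ((1 : ℝ) / 2)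

/-- `{J_1, …, J_m}`, with `J_k = ∏ᵢ [c k i, d k i]`, is a partition of `I = ∏ᵢ [aᵢ, bᵢ]`
into non-overlapping `N`-dimensional intervals covering `I`. -/
def IsBoxPartition {N : ℕ} (a b : Fin N → ℝ) {m : ℕ} (c d : Fin m → Fin N → ℝ) : Prop :=
  (∀ k i, c k i ≤ d k i) ∧
  (⋃ k, Set.pi Set.univ fun i => Set.Icc (c k i) (d k i)) =
    Set.pi Set.univ (fun i => Set.Icc (a i) (b i)) ∧
  Pairwise fun k l =>
    Disjoint (Set.pi Set.univ fun i => Set.Ioo (c k i) (d k i))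
      (Set.pi Set.univ fun i => Set.Ioo (c l i) (d l i))

/-- The multidimensional (Tonelli-type) `φ`-variation `V^φ_I[f]` of `f` on
`I = ∏ᵢ [aᵢ, bᵢ]`: the sup of `∑ₖ Φ^φ(f, J_k)` over all partitions of `I` into
`N`-dimensional intervals. -/
def varOn {N : ℕ} (φ : ℝ → ℝ) (f : (Fin N → ℝ) → ℝ) (a b : Fin N → ℝ) : ℝ≥0∞ :=
  ⨆ (m : ℕ) (c : Fin m → Fin N → ℝ) (d : Fin m → Fin N → ℝ) (_ : IsBoxPartition a b c d),
    ∑ k, boxPhi φ f (c k) (d k)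

/-- `V^φ[f]`, the `φ`-variation of `f` over the whole `ℝ^N_+`: the sup of `V^φ_I[f]`
over all intervals `I ⊂ ℝ^N_+`. -/
def totalVar {N : ℕ} (φ : ℝ → ℝ) (f : (Fin N → ℝ) → ℝ) : ℝ≥0∞ :=
  ⨆ (a : Fin N → ℝ) (b : Fin N → ℝ) (_ : ∀ i, 0 < a i) (_ : ∀ i, a i ≤ b i),
    varOn φ f a b

/-- `f ∈ BV^φ(ℝ^N_+)`: `f` measurable with `V^φ[λ f] < ∞` for some `λ > 0`. -/
def MemBVphi {N : ℕ} (φ : ℝ → ℝ) (f : (Fin N → ℝ) → ℝ) : Prop :=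
  Measurable f ∧ ∃ l > (0 : ℝ), totalVar φ (fun x => l * f x) < ⊤

/-- The Mellin-type operator `(T f)(s) := ∫_{ℝ^N_+} K(t) f(st) ⟨t⟩⁻¹ dt`. -/
def mellinOp {N : ℕ} (K : (Fin N → ℝ) → ℝ) (f : (Fin N → ℝ) → ℝ) (s : Fin N → ℝ) : ℝ :=
  ∫ t in RPos N, K t * f (s * t) * (prodCoord t)⁻¹

/-- `f` belongs to the domain of the operators `T_w`: the defining integrals exist
finitely for every `s ∈ ℝ^N_+` and `w > 0`. -/
def InDomain {N : ℕ} (K : ℝ → (Fin N → ℝ) → ℝ) (f : (Fin N → ℝ) → ℝ) : Prop :=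
  ∀ w > (0 : ℝ), ∀ s ∈ RPos N,
    IntegrableOn (fun t => K w t * f (s * t) * (prodCoord t)⁻¹) (RPos N)

/-- Condition `(K_w.1)` with absolute constant `A`: each `K_w` is measurable and
integrable w.r.t. `⟨t⟩⁻¹ dt`, with `∫ |K_w| dμ ≤ A` and `∫ K_w dμ = 1`. -/
def KernelCond1 {N : ℕ} (K : ℝ → (Fin N → ℝ) → ℝ) (A : ℝ) : Prop :=
  ∀ w > (0 : ℝ), Measurable (K w) ∧
    IntegrableOn (fun t => K w t * (prodCoord t)⁻¹) (RPos N) ∧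
    (∫ t in RPos N, |K w t| * (prodCoord t)⁻¹) ≤ A ∧
    (∫ t in RPos N, K w t * (prodCoord t)⁻¹) = 1

/-- Condition `(K_w.2)`: for every `δ ∈ (0,1)`,
`∫_{|1-t|>δ} |K_w(t)| ⟨t⟩⁻¹ dt → 0` as `w → +∞`. -/
def KernelCond2 {N : ℕ} (K : ℝ → (Fin N → ℝ) → ℝ) : Prop :=
  ∀ δ : ℝ, 0 < δ → δ < 1 →
    Tendsto (fun w => ∫ t in {t ∈ RPos N | δ < distOne t}, |K w t| * (prodCoord t)⁻¹)
      atTop (nhds 0)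

/-- The `φ`-modulus of smoothness `ω^φ(f, δ) := sup_{|1-t| ≤ δ} V^φ[τ_t f - f]`. -/
def modSmooth {N : ℕ} (φ : ℝ → ℝ) (f : (Fin N → ℝ) → ℝ) (δ : ℝ) : ℝ≥0∞ :=
  ⨆ (t : Fin N → ℝ) (_ : t ∈ RPos N) (_ : distOne t ≤ δ),
    totalVar φ (fun s => f (s * t) - f s)

/-- `f` is locally `φ`-absolutely continuous on `ℝ^N_+` (uniformly, in the sense of
Tonelli) with constant `l`. -/
def LocACphiWith {N : ℕ} (φ : ℝ → ℝ) (f : (Fin N → ℝ) → ℝ) (l : ℝ) : Prop :=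
  ∀ a b : Fin N → ℝ, (∀ i, 0 < a i) → (∀ i, a i ≤ b i) → ∀ j : Fin N,
    ∀ ε > (0 : ℝ), ∃ δ > (0 : ℝ),
      ∀ᵐ x' ∂(volume.restrict
          (Set.pi Set.univ (fun i : {i : Fin N // i ≠ j} => Set.Icc (a i.1) (b i.1)))),
        ∀ n : ℕ, ∀ α β : Fin n → ℝ,
          (∀ i, a j ≤ α i ∧ α i ≤ β i ∧ β i ≤ b j) →
          (Pairwise fun i i' =>
            Disjoint (Set.Ioo (α i) (β i)) (Set.Ioo (α i') (β i'))) →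
          (∑ i, φ (β i - α i)) < δ →
          (∑ i, φ (l * |f (insertCoord j x' (β i)) - f (insertCoord j x' (α i))|)) < ε

/-- `f ∈ AC^φ(ℝ^N_+)`: `f` is measurable, of bounded `φ`-variation and locally
`φ`-absolutely continuous on `ℝ^N_+`. -/
def MemACphi {N : ℕ} (φ : ℝ → ℝ) (f : (Fin N → ℝ) → ℝ) : Prop :=
  MemBVphi φ f ∧ ∃ l > (0 : ℝ), LocACphiWith φ f l

/-- `{K_w}` is an `α`-singular kernel: for every `δ ∈ (0,1)`,
`∫_{|1-t|>δ} |K_w(t)| ⟨t⟩⁻¹ dt = O(w^{-α})` as `w → +∞`. -/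
def AlphaSingular {N : ℕ} (K : ℝ → (Fin N → ℝ) → ℝ) (α : ℝ) : Prop :=
  ∀ δ : ℝ, 0 < δ → δ < 1 →
    (fun w => ∫ t in {t ∈ RPos N | δ < distOne t}, |K w t| * (prodCoord t)⁻¹)
      =O[atTop] fun w : ℝ => w ^ (-α)

/-- The Lipschitz class `V^φ Lip_N(α)`: `f ∈ BV^φ(ℝ^N_+)` such that, for some `μ > 0`,
`V^φ[μ(τ_t f - f)] = O(|log t|^α)` as `|1 - t| → 0`. -/
def MemLipAlpha {N : ℕ} (φ : ℝ → ℝ) (α : ℝ) (f : (Fin N → ℝ) → ℝ) : Prop :=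
  MemBVphi φ f ∧ ∃ μ > (0 : ℝ), ∃ C > (0 : ℝ), ∃ η > (0 : ℝ),
    ∀ t ∈ RPos N, distOne t ≤ η →
      totalVar φ (fun x => μ * (f (x * t) - f x)) ≤ ENNReal.ofReal (C * logNorm t ^ α)

theorem MeasureTheory.AnalyticSet.exists_isCompact_le_measure {X : Type*} [TopologicalSpace X]
    [PolishSpace X] [MeasurableSpace X] [BorelSpace X] (μ : Measure X) [IsFiniteMeasure μ]
    {A : Set X} (hA : AnalyticSet A) {r : ℝ≥0∞} (hr : r < μ A) :
    ∃ K ⊆ A, IsCompact K ∧ r ≤ μ K := by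
  rw [AnalyticSet] at hA
  rcases hA with rfl | ⟨g, hg, rfl⟩
  · simp at hr
  have step : ∀ (k : ℕ) (T : {T : Set (ℕ → ℕ) // r < μ (g '' T)}),
      ∃ m : ℕ, r < μ (g '' (T.1 ∩ {x | x k ≤ m})) := by
    rintro k ⟨T, hT⟩
    have hU : g '' T = ⋃ m : ℕ, g '' (T ∩ {x | x k ≤ m}) := by
      rw [← image_iUnion, ← inter_iUnion]
      congr 1
      ext x
      simp only [mem_inter_iff, mem_iUnion, mem_ofPred_eq]
      exact ⟨fun h => ⟨h, x k, le_rfl⟩, fun h => h.1⟩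
    have hmono : Monotone fun m : ℕ => g '' (T ∩ {x | x k ≤ m}) := fun a b hab =>
      image_mono (inter_subset_inter_right _ fun x hx => le_trans hx hab)
    rw [hU, hmono.measure_iUnion, lt_iSup_iff] at hT
    exact hT
  choose m hm using step
  let T : ℕ → {T : Set (ℕ → ℕ) // r < μ (g '' T)} := fun k =>
    Nat.rec ⟨univ, by simpa using hr⟩ (fun k T => ⟨_, hm k T⟩) k
  let n : ℕ → ℕ := fun k => m k (T k)
  have hT : ∀ k, (T k).1 = {x | ∀ i < k, x i ≤ n i} := by
    intro k
    induction k with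
    | zero => simp [T]
    | succ k ih =>
      have : (T (k + 1)).1 = (T k).1 ∩ {x | x k ≤ n k} := rfl
      rw [this, ih]
      ext x
      simp only [mem_inter_iff, mem_ofPred_eq, Nat.lt_succ_iff_lt_or_eq]
      exact ⟨fun h i hi => hi.elim (h.1 i) (by rintro rfl; exact h.2),
        fun h => ⟨fun i hi => h i (Or.inl hi), h k (Or.inr rfl)⟩⟩
  have hK : IsCompact (Set.pi univ fun i => Iic (n i)) :=
    isCompact_univ_pi fun i => (finite_Iic (n i)).isCompact
  refine ⟨_, image_subset_range _ _, hK.image hg, ?_⟩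
  rw [Set.measure_eq_iInf_isOpen]
  refine le_iInf₂ fun U hU => le_iInf fun hUo => ?_
  by_contra! hlt
  have hex : ∀ k, ∃ x ∈ (T k).1, g x ∉ U := by
    intro k
    by_contra! h
    exact absurd ((T k).2.trans_le (measure_mono (image_subset_iff.2 h))) hlt.not_gt
  choose x hxT hxU using hex
  obtain ⟨y, hy, ψ, hψ, hlim⟩ := hK.tendsto_subseq (x := fun k i => min (x k i) (n i))
    fun k i _ => mem_Iic.2 (min_le_right (x k i) (n i))
  have hlim' : Tendsto (x ∘ ψ) atTop (nhds y) := by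
    rw [tendsto_pi_nhds] at hlim ⊢
    intro i
    refine (hlim i).congr' ?_
    filter_upwards [eventually_gt_atTop i] with k hk
    have h := hxT (ψ k)
    rw [hT] at h
    exact min_eq_left (h i (hk.trans_le hψ.le_apply))
  have hev := ((hg.tendsto y).comp hlim').eventually (hUo.mem_nhds (hU ⟨y, hy, rfl⟩))
  obtain ⟨k, hk⟩ := hev.exists
  exact hxU _ hk

theorem MeasureTheory.AnalyticSet.nullMeasurableSet {X : Type*} [TopologicalSpace X]
    [PolishSpace X] [MeasurableSpace X] [BorelSpace X] (μ : Measure X) [SFinite μ]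
    {A : Set X} (hA : AnalyticSet A) : NullMeasurableSet A μ := by
  obtain ⟨ν, hν, hμν, -⟩ := exists_isFiniteMeasure_absolutelyContinuous μ
  refine NullMeasurableSet.mono_ac ?_ hμν
  have hex : ∃ B ⊆ A, MeasurableSet B ∧ ν A ≤ ν B := by
    rcases eq_or_ne (ν A) 0 with h0 | h0
    · exact ⟨∅, empty_subset _, .empty, by simp [h0]⟩
    obtain ⟨u, -, hu, hlim⟩ := exists_seq_strictMono_tendsto' (pos_iff_ne_zero.2 h0)
    choose K hKA hK hr using fun k => hA.exists_isCompact_le_measure ν (hu k).2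
    refine ⟨⋃ k, K k, iUnion_subset hKA, .iUnion fun k => (hK k).measurableSet, ?_⟩
    exact le_of_tendsto' hlim fun k => (hr k).trans (measure_mono (subset_iUnion K k))
  obtain ⟨B, hBA, hB, hle⟩ := hex
  refine ⟨B, hB, ?_⟩
  exact (ae_eq_of_subset_of_measure_ge hBA hle hB.nullMeasurableSet (measure_ne_top _ _)).symm

theorem Measurable.aemeasurable_biSup_section {X Y : Type*} [TopologicalSpace X]
    [PolishSpace X] [MeasurableSpace X] [BorelSpace X] [TopologicalSpace Y]
    [PolishSpace Y] [MeasurableSpace Y] [BorelSpace Y] (μ : Measure X) [SFinite μ]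
    {G : X × Y → ℝ≥0∞} (hG : Measurable G) {S : Set Y} (hS : MeasurableSet S) :
    AEMeasurable (fun x => ⨆ y ∈ S, G (x, y)) μ := by
  have h : NullMeasurable (fun x => ⨆ y ∈ S, G (x, y)) μ := by
    refine measurable_of_Ioi (δ := NullMeasurableSpace X μ) fun c => ?_
    change NullMeasurableSet ((fun x : X => ⨆ y ∈ S, G (x, y)) ⁻¹' Ioi c) μ
    have : (fun x => ⨆ y ∈ S, G (x, y)) ⁻¹' Ioi c =
        Prod.fst '' ((G ⁻¹' Ioi c) ∩ (Prod.snd ⁻¹' S)) := by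
      ext x
      simp only [mem_preimage, mem_Ioi, lt_iSup_iff, mem_image, mem_inter_iff, Prod.exists,
        exists_and_right, exists_eq_right, exists_prop]
      exact exists_congr fun _ => and_comm
    rw [this]
    exact (((hG measurableSet_Ioi).inter (measurable_snd hS)).analyticSet_image
      measurable_fst).nullMeasurableSet μ
  exact h.aemeasurable

theorem ofReal_convex_integral_mul_le {X : Type*} [MeasurableSpace X] {μ : Measure X}
    {ψ : ℝ → ℝ} (hψ : ConvexOn ℝ univ ψ) (habs : ∀ x, ψ |x| = ψ x) (hnn : ∀ x, 0 ≤ ψ x)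
    (hmono : MonotoneOn ψ (Ici 0)) {k h : X → ℝ} (hk : Measurable k) (hh : Measurable h)
    (hki : Integrable k μ) (hkh : Integrable (fun x => k x * h x) μ) {A : ℝ}
    (h1 : 1 ≤ ∫ x, |k x| ∂μ) (hA : ∫ x, |k x| ∂μ ≤ A) :
    ENNReal.ofReal (ψ (∫ x, k x * h x ∂μ)) ≤
      ∫⁻ x, ENNReal.ofReal |k x| * ENNReal.ofReal (ψ (A * h x)) ∂μ := by
  by_cases htop : ∫⁻ x, ENNReal.ofReal |k x| * ENNReal.ofReal (ψ (A * h x)) ∂μ = ⊤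
  · simp [htop]
  have hcont : Continuous ψ := continuousOn_univ.1 (hψ.continuousOn isOpen_univ)
  set M := ∫ x, |k x| ∂μ with hM
  have hkm : Measurable fun x => ‖k x‖₊ := by fun_prop
  have hknn : ∀ x, (‖k x‖₊ : ℝ) = |k x| := fun x => rfl
  set ν := μ.withDensity fun x => (‖k x‖₊ : ℝ≥0∞) with hν
  have hint : ∀ g : X → ℝ, ∫ x, g x ∂ν = ∫ x, |k x| * g x ∂μ := fun g =>
    integral_withDensity_eq_integral_smul hkm g
  have hinteg : ∀ g : X → ℝ, Integrable g ν ↔ Integrable (fun x => |k x| * g x) μ := fun g =>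
    integrable_withDensity_iff_integrable_smul hkm
  have : IsFiniteMeasure ν := by
    have := (hinteg fun _ => 1).2 (by simpa using hki.abs)
    exact (integrable_const_iff_isFiniteMeasure one_ne_zero).1 this
  have hνM : ν.real univ = M := by simpa using hint fun _ => 1
  have : NeZero ν := ⟨by
    rintro h0
    rw [h0] at hνM
    simp at hνM
    linarith⟩
  have hA0 : 0 ≤ A := by linarith
  have hAint : Integrable (fun x => |k x| * ψ (A * h x)) μ := by
    refine ⟨by fun_prop, ?_⟩
    rw [hasFiniteIntegral_iff_ofReal (ae_of_all _ fun x => mul_nonneg (abs_nonneg _) (hnn _))]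
    simp_rw [ENNReal.ofReal_mul (abs_nonneg _)]
    exact lt_top_iff_ne_top.2 htop
  have hMA : ∀ x, ψ (M * |h x|) ≤ ψ (A * h x) := fun x => by
    rw [← habs (A * h x), abs_mul, abs_of_nonneg hA0]
    exact hmono (mem_Ici.2 (by positivity)) (mem_Ici.2 (by positivity)) (by gcongr)
  have hMint : Integrable (fun x => |k x| * ψ (M * |h x|)) μ := by
    refine hAint.mono' (by fun_prop) (ae_of_all _ fun x => ?_)
    rw [Real.norm_of_nonneg (mul_nonneg (abs_nonneg _) (hnn _))]
    exact mul_le_mul_of_nonneg_left (hMA x) (abs_nonneg _)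
  have hfi : Integrable (fun x => M * |h x|) ν := by
    refine Integrable.const_mul ((hinteg _).2 ?_) M
    simpa [abs_mul] using hkh.abs
  have hJ := hψ.map_average_le hcont.continuousOn isClosed_univ (by simp) hfi ((hinteg _).2 hMint)
  rw [average_eq, average_eq, hνM, integral_const_mul, smul_eq_mul, smul_eq_mul,
    inv_mul_cancel_left₀ (by linarith), hint, hint] at hJ
  have hle : ψ (∫ x, k x * h x ∂μ) ≤ ∫ x, |k x| * ψ (A * h x) ∂μ := by
    calc ψ (∫ x, k x * h x ∂μ) ≤ ψ (∫ x, |k x| * |h x| ∂μ) := by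
          rw [← habs]
          refine hmono (mem_Ici.2 (abs_nonneg _)) (mem_Ici.2 (by positivity)) ?_
          simpa only [abs_mul] using abs_integral_le_integral_abs (f := fun x => k x * h x) (μ := μ)
      _ ≤ M⁻¹ * ∫ x, |k x| * ψ (M * |h x|) ∂μ := hJ
      _ ≤ ∫ x, |k x| * ψ (M * |h x|) ∂μ :=
          mul_le_of_le_one_left (integral_nonneg fun x => mul_nonneg (abs_nonneg _) (hnn _))
            (inv_le_one_of_one_le₀ h1)
      _ ≤ ∫ x, |k x| * ψ (A * h x) ∂μ :=
          integral_mono hMint hAint fun x => mul_le_mul_of_nonneg_left (hMA x) (abs_nonneg _)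
  refine (ENNReal.ofReal_le_ofReal hle).trans_eq ?_
  rw [ofReal_integral_eq_lintegral_ofReal hAint
    (ae_of_all _ fun x => mul_nonneg (abs_nonneg _) (hnn _))]
  simp_rw [ENNReal.ofReal_mul (abs_nonneg _)]

theorem Finset.sum_lintegral_le {X ι : Type*} [MeasurableSpace X] {μ : Measure X} (s : Finset ι)
    (F : ι → X → ℝ≥0∞) : ∑ i ∈ s, ∫⁻ x, F i x ∂μ ≤ ∫⁻ x, ∑ i ∈ s, F i x ∂μ := by
  classical
  induction s using Finset.induction_on with
  | empty => simp
  | insert a s ha ih =>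
    simp only [Finset.sum_insert ha]
    exact (add_le_add le_rfl ih).trans (le_lintegral_add _ _)

theorem IsPhiFun.monotoneOn {φ : ℝ → ℝ} (hφ : IsPhiFun φ) : MonotoneOn φ (Ici 0) := by
  obtain ⟨hc, hnn, hz, -⟩ := hφ
  have h0 : φ 0 = 0 := (hz 0 le_rfl).2 rfl
  intro x hx y hy hxy
  rcases eq_or_lt_of_le (mem_Ici.1 hy) with rfl | hy0
  · rw [le_antisymm hxy hx]
  have h := hc.2 hy (mem_Ici.2 le_rfl) (div_nonneg (mem_Ici.1 hx) hy0.le)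
    (sub_nonneg.2 ((div_le_one hy0).2 hxy)) (by ring)
  simp only [smul_eq_mul, h0, mul_zero, add_zero, div_mul_cancel₀ x hy0.ne'] at h
  exact h.trans (mul_le_of_le_one_left (hnn y hy) ((div_le_one hy0).2 hxy))

theorem IsPhiFun.nonneg_abs {φ : ℝ → ℝ} (hφ : IsPhiFun φ) (x : ℝ) : 0 ≤ φ |x| :=
  hφ.2.1 _ (abs_nonneg x)

theorem IsPhiFun.convexOn_abs {φ : ℝ → ℝ} (hφ : IsPhiFun φ) :
    ConvexOn ℝ univ fun x => φ |x| := by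
  refine ⟨convex_univ, fun x _ y _ a b ha hb hab => ?_⟩
  refine le_trans (hφ.monotoneOn (mem_Ici.2 (abs_nonneg _)) (mem_Ici.2 (by positivity)) ?_)
    (hφ.1.2 (mem_Ici.2 (abs_nonneg x)) (mem_Ici.2 (abs_nonneg y)) ha hb hab)
  simpa [abs_mul, abs_of_nonneg ha, abs_of_nonneg hb] using abs_add_le (a * x) (b * y)

theorem IsPhiFun.continuous_abs {φ : ℝ → ℝ} (hφ : IsPhiFun φ) : Continuous fun x => φ |x| :=
  continuousOn_univ.1 (hφ.convexOn_abs.continuousOn isOpen_univ)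

theorem IsPhiFun.abs_mul_le {φ : ℝ → ℝ} (hφ : IsPhiFun φ) {r s : ℝ} (hr : 0 ≤ r) (hrs : r ≤ s)
    (x : ℝ) : φ |r * x| ≤ φ |s * x| :=
  hφ.monotoneOn (mem_Ici.2 (abs_nonneg _)) (mem_Ici.2 (abs_nonneg _)) (by
    rw [abs_mul, abs_mul, abs_of_nonneg hr, abs_of_nonneg (hr.trans hrs)]
    gcongr)

theorem IsPhiFun.abs_sub_le {φ : ℝ → ℝ} (hφ : IsPhiFun φ) (x y : ℝ) :
    φ |x - y| ≤ φ |2 * x| + φ |2 * y| := by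
  have h := hφ.convexOn_abs.2 (mem_univ (2 * x)) (mem_univ (-(2 * y)))
    (one_half_pos (α := ℝ)).le (one_half_pos (α := ℝ)).le (by norm_num)
  simp only [smul_eq_mul, abs_neg] at h
  rw [show 1 / 2 * (2 * x) + 1 / 2 * -(2 * y) = x - y by ring] at h
  linarith [hφ.nonneg_abs (2 * x), hφ.nonneg_abs (2 * y)]

theorem phiVar1_le {φ : ℝ → ℝ} {a b : ℝ} {g : ℝ → ℝ} {B : ℝ≥0∞}
    (h : ∀ (n : ℕ) (u : Fin (n + 1) → ℝ), Monotone u → u 0 = a → u (Fin.last n) = b →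
      (∀ i, u i ∈ Icc a b) →
      ∑ i : Fin n, ENNReal.ofReal (φ |g (u i.succ) - g (u i.castSucc)|) ≤ B) :
    phiVar1 φ a b g ≤ B :=
  iSup_le fun n => iSup_le fun u => iSup_le fun hu => iSup_le fun ha => iSup_le fun hb =>
    h n u hu ha hb fun i => ⟨ha ▸ hu (Fin.zero_le i), hb ▸ hu (Fin.le_last i)⟩

theorem le_phiVar1 (φ : ℝ → ℝ) {a b : ℝ} (g : ℝ → ℝ) {n : ℕ} {u : Fin (n + 1) → ℝ}
    (hu : Monotone u) (ha : u 0 = a) (hb : u (Fin.last n) = b) :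
    ∑ i : Fin n, ENNReal.ofReal (φ |g (u i.succ) - g (u i.castSucc)|) ≤ phiVar1 φ a b g :=
  le_iSup_of_le n <| le_iSup_of_le u <| le_iSup_of_le hu <| le_iSup_of_le ha <|
    le_iSup_of_le hb le_rfl

theorem phiVar1_mono {φ : ℝ → ℝ} {a b : ℝ} {g h : ℝ → ℝ}
    (hgh : ∀ s ∈ Icc a b, ∀ r ∈ Icc a b, φ |g s - g r| ≤ φ |h s - h r|) :
    phiVar1 φ a b g ≤ phiVar1 φ a b h :=
  phiVar1_le fun _ _ hu ha hb hI =>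
    (Finset.sum_le_sum fun _ _ => ENNReal.ofReal_le_ofReal (hgh _ (hI _) _ (hI _))).trans
      (le_phiVar1 φ h hu ha hb)

theorem phiVar1_sub_le {φ : ℝ → ℝ} (hφ : IsPhiFun φ) (a b : ℝ) (g h : ℝ → ℝ) :
    phiVar1 φ a b (fun s => g s - h s) ≤
      phiVar1 φ a b (fun s => 2 * g s) + phiVar1 φ a b (fun s => 2 * h s) := by
  refine phiVar1_le fun n u hu ha hb _ => ?_
  refine le_trans ?_ (add_le_add (le_phiVar1 φ _ hu ha hb) (le_phiVar1 φ _ hu ha hb))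
  rw [← Finset.sum_add_distrib]
  refine Finset.sum_le_sum fun i _ => ?_
  rw [← ENNReal.ofReal_add (hφ.nonneg_abs _) (hφ.nonneg_abs _)]
  refine ENNReal.ofReal_le_ofReal ?_
  convert hφ.abs_sub_le (g (u i.succ) - g (u i.castSucc)) (h (u i.succ) - h (u i.castSucc))
    using 3 <;> ring_nf

theorem phiVar1_comp_mul_le (φ : ℝ → ℝ) {a b r : ℝ} (hr : 0 ≤ r) (g : ℝ → ℝ) :
    phiVar1 φ a b (fun s => g (s * r)) ≤ phiVar1 φ (a * r) (b * r) g :=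
  phiVar1_le fun _ u hu ha hb _ => le_phiVar1 φ g (u := fun i => u i * r)
    (fun _ _ hij => mul_le_mul_of_nonneg_right (hu hij) hr) (by simp [ha]) (by simp [hb])

theorem aemeasurable_phiVar1 {φ : ℝ → ℝ} (hφ : IsPhiFun φ) {X : Type*} [TopologicalSpace X]
    [PolishSpace X] [MeasurableSpace X] [BorelSpace X] (μ : Measure X) [SFinite μ]
    {g : X → ℝ → ℝ} (hg : Measurable fun p : X × ℝ => g p.1 p.2) (a b : ℝ) :
    AEMeasurable (fun x => phiVar1 φ a b (g x)) μ := by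
  have hcm := hφ.continuous_abs.measurable
  refine AEMeasurable.iSup fun n => ?_
  have hS : MeasurableSet
      {u : Fin (n + 1) → ℝ | Monotone u ∧ u 0 = a ∧ u (Fin.last n) = b} :=
    (isClosed_monotone.inter ((isClosed_eq (by fun_prop) (by fun_prop)).inter
      (isClosed_eq (by fun_prop) (by fun_prop)))).measurableSet
  have hG : Measurable fun p : X × (Fin (n + 1) → ℝ) =>
      ∑ i : Fin n, ENNReal.ofReal (φ |g p.1 (p.2 i.succ) - g p.1 (p.2 i.castSucc)|) := by
    refine Finset.measurable_sum _ fun i _ => ENNReal.measurable_ofReal.comp (hcm.comp ?_)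
    exact (hg.comp (f := fun p : X × (Fin (n + 1) → ℝ) => (p.1, p.2 i.succ)) (by fun_prop)).sub
      (hg.comp (f := fun p : X × (Fin (n + 1) → ℝ) => (p.1, p.2 i.castSucc)) (by fun_prop))
  simpa only [mem_ofPred_eq, iSup_and] using hG.aemeasurable_biSup_section μ hS

theorem measurable_insertCoord {N : ℕ} (j : Fin N) :
    Measurable fun p : ({i : Fin N // i ≠ j} → ℝ) × ℝ => insertCoord j p.1 p.2 := by
  refine measurable_pi_lambda _ fun i => ?_
  unfold insertCoord
  split_ifs
  · fun_prop
  · fun_prop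

theorem insertCoord_mem_RPos {N : ℕ} {a b : Fin N → ℝ} (ha : ∀ i, 0 < a i) {j : Fin N}
    {x' : {i : Fin N // i ≠ j} → ℝ}
    (hx' : x' ∈ Set.pi Set.univ fun i : {i : Fin N // i ≠ j} => Set.Icc (a i.1) (b i.1))
    {s : ℝ} (hs : s ∈ Icc (a j) (b j)) : insertCoord j x' s ∈ RPos N := by
  intro i
  unfold insertCoord
  split_ifs with h
  · exact (ha j).trans_le hs.1
  · exact (ha i).trans_le (hx' ⟨i, h⟩ trivial).1

theorem measurableSet_sectionBox {N : ℕ} (a b : Fin N → ℝ) (j : Fin N) :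
    MeasurableSet (Set.pi Set.univ fun i : {i : Fin N // i ≠ j} => Set.Icc (a i.1) (b i.1)) :=
  .univ_pi fun _ => measurableSet_Icc

theorem secVar_mono {N : ℕ} {φ : ℝ → ℝ} {F G : (Fin N → ℝ) → ℝ}
    (hFG : ∀ x ∈ RPos N, ∀ y ∈ RPos N, φ |F x - F y| ≤ φ |G x - G y|) {a b : Fin N → ℝ}
    (ha : ∀ i, 0 < a i) (j : Fin N) : secVar φ F a b j ≤ secVar φ G a b j :=
  setLIntegral_mono' (measurableSet_sectionBox a b j) fun x' hx' => by
    gcongr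
    exact phiVar1_mono fun s hs r hr =>
      hFG _ (insertCoord_mem_RPos ha hx' hs) _ (insertCoord_mem_RPos ha hx' hr)

theorem secVar_sub_le {N : ℕ} {φ : ℝ → ℝ} (hφ : IsPhiFun φ) {F : (Fin N → ℝ) → ℝ}
    (hF : Measurable F) (G : (Fin N → ℝ) → ℝ) (a b : Fin N → ℝ) (j : Fin N) :
    secVar φ (fun x => F x - G x) a b j ≤
      secVar φ (fun x => 2 * F x) a b j + secVar φ (fun x => 2 * G x) a b j := by
  unfold secVar
  rw [← lintegral_add_left']
  · refine lintegral_mono fun x' => ?_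
    dsimp only
    rw [← add_mul]
    gcongr
    exact phiVar1_sub_le hφ _ _ _ _
  · refine AEMeasurable.mul (aemeasurable_phiVar1 hφ _ ?_ _ _) (by fun_prop)
    exact (hF.comp (measurable_insertCoord j)).const_mul 2

theorem secVar_integral_le {N : ℕ} {φ : ℝ → ℝ} (hφ : IsPhiFun φ) {k f H : (Fin N → ℝ) → ℝ}
    (hk : Measurable k) (hf : Measurable f) (hki : IntegrableOn k (RPos N)) {A c : ℝ}
    (h1 : 1 ≤ ∫ t in RPos N, |k t|) (hA : ∫ t in RPos N, |k t| ≤ A)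
    (hkf : ∀ s ∈ RPos N, IntegrableOn (fun t => k t * f (s * t)) (RPos N))
    (hH : ∀ s ∈ RPos N, H s = ∫ t in RPos N, k t * (c * (f (s * t) - f s)))
    {a b : Fin N → ℝ} (ha : ∀ i, 0 < a i) (j : Fin N) :
    secVar φ H a b j ≤ ∫⁻ t in RPos N, ENNReal.ofReal |k t| *
      secVar φ (fun x => A * (c * (f (x * t) - f x))) a b j := by
  have hint : ∀ s ∈ RPos N,
      IntegrableOn (fun t => k t * (c * (f (s * t) - f s))) (RPos N) := fun s hs => by
    have := ((hkf s hs).sub (hki.mul_const (f s))).const_mul c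
    refine this.congr (ae_of_all _ fun t => ?_)
    simp only [Pi.sub_apply]
    ring
  have hmeas : Measurable fun p : (({i : Fin N // i ≠ j} → ℝ) × (Fin N → ℝ)) × ℝ =>
      A * (c * (f (insertCoord j p.1.1 p.2 * p.1.2) - f (insertCoord j p.1.1 p.2))) := by
    have h : Measurable fun p : (({i : Fin N // i ≠ j} → ℝ) × (Fin N → ℝ)) × ℝ =>
        insertCoord j p.1.1 p.2 :=
      (measurable_insertCoord j).comp
        (f := fun p : (({i : Fin N // i ≠ j} → ℝ) × (Fin N → ℝ)) × ℝ => (p.1.1, p.2))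
        (by fun_prop)
    exact (((hf.comp (h.mul (by fun_prop))).sub (hf.comp h)).const_mul c).const_mul A
  set V : ({i : Fin N // i ≠ j} → ℝ) → (Fin N → ℝ) → ℝ≥0∞ := fun x' t =>
    phiVar1 φ (a j) (b j)
      (fun s => A * (c * (f (insertCoord j x' s * t) - f (insertCoord j x' s)))) with hV
  have hsec : ∀ x' ∈ Set.pi Set.univ fun i : {i : Fin N // i ≠ j} => Set.Icc (a i.1) (b i.1),
      phiVar1 φ (a j) (b j) (fun s => H (insertCoord j x' s)) ≤
        ∫⁻ t in RPos N, ENNReal.ofReal |k t| * V x' t := by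
    intro x' hx'
    refine phiVar1_le fun n u hu h0 hl hI => ?_
    have hpos : ∀ i, insertCoord j x' (u i) ∈ RPos N := fun i =>
      insertCoord_mem_RPos ha hx' (hI i)
    have hfm : ∀ s : Fin N → ℝ, Measurable fun t => f (s * t) := fun s =>
      hf.comp (measurable_const_mul s)
    calc _ ≤ ∑ i : Fin n, ∫⁻ t in RPos N, ENNReal.ofReal |k t| *
            ENNReal.ofReal (φ |A * (c * (f (insertCoord j x' (u i.succ) * t) -
                f (insertCoord j x' (u i.succ))) - c * (f (insertCoord j x' (u i.castSucc) * t) -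
                f (insertCoord j x' (u i.castSucc))))|) := by
          refine Finset.sum_le_sum fun i _ => ?_
          have hs := hint _ (hpos i.succ)
          have hr := hint _ (hpos i.castSucc)
          rw [hH _ (hpos _), hH _ (hpos _), ← integral_sub hs hr]
          simp_rw [← mul_sub]
          refine ofReal_convex_integral_mul_le (ψ := fun x => φ |x|) hφ.convexOn_abs
            (fun x => by simp) hφ.nonneg_abs (fun x hx y hy hxy => ?_) hk
            (by have := hfm; fun_prop) hki ?_ h1 hA
          · simpa only [abs_of_nonneg (mem_Ici.1 hx), abs_of_nonneg (mem_Ici.1 hy)] using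
              hφ.monotoneOn hx hy hxy
          · refine (hs.sub hr).congr (ae_of_all _ fun t => ?_)
            simp only [Pi.sub_apply]
            ring
      _ ≤ ∫⁻ t in RPos N, ∑ i : Fin n, _ := Finset.sum_lintegral_le _ _
      _ ≤ _ := by
          refine lintegral_mono fun t => ?_
          rw [← Finset.mul_sum]
          gcongr
          simp_rw [mul_sub A]
          exact le_phiVar1 φ _ hu h0 hl
  calc secVar φ H a b j
      ≤ ∫⁻ x' in Set.pi Set.univ (fun i : {i : Fin N // i ≠ j} => Set.Icc (a i.1) (b i.1)),
          ∫⁻ t in RPos N, ENNReal.ofReal |k t| * V x' t *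
            ENNReal.ofReal ((∏ i : {i : Fin N // i ≠ j}, x' i)⁻¹) := by
        refine setLIntegral_mono' (measurableSet_sectionBox a b j) fun x' hx' => ?_
        rw [lintegral_mul_const' _ _ ENNReal.ofReal_ne_top]
        gcongr
        exact hsec x' hx'
    _ = ∫⁻ t in RPos N,
        ∫⁻ x' in Set.pi Set.univ (fun i : {i : Fin N // i ≠ j} => Set.Icc (a i.1) (b i.1)),
          ENNReal.ofReal |k t| * V x' t *
            ENNReal.ofReal ((∏ i : {i : Fin N // i ≠ j}, x' i)⁻¹) := by
        refine lintegral_lintegral_swap ?_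
        refine AEMeasurable.mul (AEMeasurable.mul (by fun_prop) ?_) (by fun_prop)
        exact aemeasurable_phiVar1 hφ _ hmeas _ _
    _ ≤ _ := by
        refine lintegral_mono fun t => ?_
        simp_rw [mul_assoc]
        rw [lintegral_const_mul' _ _ ENNReal.ofReal_ne_top]
        rfl

theorem secVar_comp_mul_le {N : ℕ} (φ : ℝ → ℝ) (f : (Fin N → ℝ) → ℝ) (a b : Fin N → ℝ)
    {t : Fin N → ℝ} (ht : t ∈ RPos N) (j : Fin N) :
    secVar φ (fun x => f (x * t)) a b j ≤ secVar φ f (a * t) (b * t) j := by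
  set τ : {i : Fin N // i ≠ j} → ℝ := fun i => t i.1 with hτ
  have hτpos : ∀ i, 0 < τ i := fun i => ht i.1
  have hP : 0 < ∏ i, τ i := Finset.prod_pos fun i _ => hτpos i
  have hdet : Matrix.det (Matrix.diagonal τ) ≠ 0 := by
    rw [Matrix.det_diagonal]
    exact hP.ne'
  have hvol := Real.smul_map_diagonal_volume_pi hdet
  have hfun : (⇑(Matrix.toLin' (Matrix.diagonal τ)) : _ → _) = fun x' => x' * τ := by
    ext x' i
    simp [Matrix.mulVec_diagonal, mul_comm]
  rw [hfun, Matrix.det_diagonal, abs_of_pos hP] at hvol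
  have hemb : MeasurableEmbedding fun x' : {i : Fin N // i ≠ j} → ℝ => x' * τ := by
    refine Continuous.measurableEmbedding (by fun_prop) fun x y hxy => funext fun i => ?_
    exact mul_right_cancel₀ (hτpos i).ne' (congrFun hxy i)
  have hpre : (fun x' : {i : Fin N // i ≠ j} → ℝ => x' * τ) ⁻¹'
      (Set.pi Set.univ fun i => Set.Icc ((a * t) i.1) ((b * t) i.1)) =
      Set.pi Set.univ fun i : {i : Fin N // i ≠ j} => Set.Icc (a i.1) (b i.1) := by
    ext x'
    simp only [mem_preimage, mem_univ_pi, mem_Icc, Pi.mul_apply, hτ]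
    exact forall_congr' fun i => by
      rw [mul_le_mul_iff_left₀ (ht i.1), mul_le_mul_iff_left₀ (ht i.1)]
  unfold secVar
  conv_rhs => rw [← hvol]
  rw [Measure.restrict_smul, lintegral_smul_measure, hemb.restrict_map, hemb.lintegral_map, hpre,
    smul_eq_mul, ← lintegral_const_mul' _ _ ENNReal.ofReal_ne_top]
  refine lintegral_mono fun x' => ?_
  dsimp only
  have hw : ENNReal.ofReal (∏ i, τ i) *
      ENNReal.ofReal ((∏ i : {i : Fin N // i ≠ j}, (x' * τ) i)⁻¹) =
      ENNReal.ofReal ((∏ i : {i : Fin N // i ≠ j}, x' i)⁻¹) := by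
    rw [← ENNReal.ofReal_mul hP.le]
    simp only [Pi.mul_apply, Finset.prod_mul_distrib, mul_inv]
    rw [mul_comm, inv_mul_cancel_right₀ hP.ne']
  rw [mul_left_comm, hw]
  gcongr
  refine le_of_eq_of_le ?_ (phiVar1_comp_mul_le φ (ht j).le
    (fun s => f (insertCoord j (x' * τ) s)))
  congr 1
  ext s
  congr 1
  ext i
  unfold insertCoord
  by_cases h : i = j
  · subst h
    simp
  · simp [h, hτ]

/-- The sum over `k` and `j` of the section variations `Φ^φ_j(f, J_k)`, `J_k = ∏ᵢ [c k i, d k i]`. -/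
def sumVar {N : ℕ} (φ : ℝ → ℝ) (f : (Fin N → ℝ) → ℝ) {m : ℕ} (c d : Fin m → Fin N → ℝ) :
    ℝ≥0∞ :=
  ∑ k, ∑ j, secVar φ f (c k) (d k) j

theorem secVar_le_boxPhi {N : ℕ} (φ : ℝ → ℝ) (f : (Fin N → ℝ) → ℝ) (a b : Fin N → ℝ)
    (j : Fin N) : secVar φ f a b j ≤ boxPhi φ f a b := by
  have h : secVar φ f a b j ^ 2 ≤ ∑ j, secVar φ f a b j ^ 2 :=
    Finset.single_le_sum (f := fun j => secVar φ f a b j ^ 2) (fun _ _ => zero_le)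
      (Finset.mem_univ j)
  refine le_of_eq_of_le ?_ (ENNReal.rpow_le_rpow h (by norm_num : (0 : ℝ) ≤ 1 / 2))
  rw [← ENNReal.rpow_natCast, ← ENNReal.rpow_mul]
  norm_num

theorem boxPhi_le_sum {N : ℕ} (φ : ℝ → ℝ) (f : (Fin N → ℝ) → ℝ) (a b : Fin N → ℝ) :
    boxPhi φ f a b ≤ ∑ j, secVar φ f a b j := by
  have h : ∑ j, secVar φ f a b j ^ 2 ≤ (∑ j, secVar φ f a b j) ^ 2 := by
    rw [sq, Finset.sum_mul]
    refine Finset.sum_le_sum fun j hj => ?_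
    rw [sq]
    gcongr
    exact Finset.single_le_sum (f := fun j => secVar φ f a b j) (fun _ _ => zero_le) hj
  refine (ENNReal.rpow_le_rpow h (by norm_num : (0 : ℝ) ≤ 1 / 2)).trans_eq ?_
  rw [← ENNReal.rpow_natCast, ← ENNReal.rpow_mul]
  norm_num

theorem IsBoxPartition.pos {N : ℕ} {a b : Fin N → ℝ} (ha : ∀ i, 0 < a i) {m : ℕ}
    {c d : Fin m → Fin N → ℝ} (h : IsBoxPartition a b c d) (k : Fin m) (i : Fin N) :
    0 < c k i := by
  have hc : c k ∈ ⋃ k, Set.pi Set.univ fun i => Set.Icc (c k i) (d k i) :=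
    mem_iUnion.2 ⟨k, fun i _ => ⟨le_rfl, h.1 k i⟩⟩
  rw [h.2.1] at hc
  exact (ha i).trans_le (hc i trivial).1

theorem IsBoxPartition.mul {N : ℕ} {a b : Fin N → ℝ} {m : ℕ} {c d : Fin m → Fin N → ℝ}
    (h : IsBoxPartition a b c d) {t : Fin N → ℝ} (ht : t ∈ RPos N) :
    IsBoxPartition (a * t) (b * t) (fun k => c k * t) (fun k => d k * t) := by
  have hIcc : ∀ c d : Fin N → ℝ, (Set.pi Set.univ fun i => Set.Icc ((c * t) i) ((d * t) i)) =
      (fun x => x / t) ⁻¹' Set.pi Set.univ fun i => Set.Icc (c i) (d i) := fun c d => by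
    ext x
    simp only [mem_univ_pi, mem_Icc, mem_preimage, Pi.mul_apply, Pi.div_apply]
    exact forall_congr' fun i => by rw [le_div_iff₀ (ht i), div_le_iff₀ (ht i)]
  have hIoo : ∀ c d : Fin N → ℝ, (Set.pi Set.univ fun i => Set.Ioo ((c * t) i) ((d * t) i)) =
      (fun x => x / t) ⁻¹' Set.pi Set.univ fun i => Set.Ioo (c i) (d i) := fun c d => by
    ext x
    simp only [mem_univ_pi, mem_Ioo, mem_preimage, Pi.mul_apply, Pi.div_apply]
    exact forall_congr' fun i => by rw [lt_div_iff₀ (ht i), div_lt_iff₀ (ht i)]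
  refine ⟨fun k i => mul_le_mul_of_nonneg_right (h.1 k i) (ht i).le, ?_, fun k l hkl => ?_⟩
  · simp_rw [hIcc]
    rw [← preimage_iUnion, h.2.1]
  · dsimp only
    rw [hIoo, hIoo]
    exact (h.2.2 hkl).preimage _

theorem totalVar_le_of_sumVar_le {N : ℕ} {φ : ℝ → ℝ} {f : (Fin N → ℝ) → ℝ} {B : ℝ≥0∞}
    (h : ∀ (a b : Fin N → ℝ), (∀ i, 0 < a i) → (∀ i, a i ≤ b i) → ∀ (m : ℕ)
      (c d : Fin m → Fin N → ℝ), IsBoxPartition a b c d → sumVar φ f c d ≤ B) :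
    totalVar φ f ≤ B :=
  iSup_le fun a => iSup_le fun b => iSup_le fun ha => iSup_le fun hab => iSup_le fun m =>
    iSup_le fun c => iSup_le fun d => iSup_le fun hcd =>
      (Finset.sum_le_sum fun _ _ => boxPhi_le_sum φ f _ _).trans (h a b ha hab m c d hcd)

theorem sumVar_le_mul_totalVar {N : ℕ} (φ : ℝ → ℝ) (f : (Fin N → ℝ) → ℝ) {a b : Fin N → ℝ}
    (ha : ∀ i, 0 < a i) (hab : ∀ i, a i ≤ b i) {m : ℕ} {c d : Fin m → Fin N → ℝ}
    (h : IsBoxPartition a b c d) : sumVar φ f c d ≤ N * totalVar φ f := by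
  have hbox : ∑ k, boxPhi φ f (c k) (d k) ≤ totalVar φ f :=
    le_iSup_of_le a <| le_iSup_of_le b <| le_iSup_of_le ha <| le_iSup_of_le hab <|
      le_iSup_of_le m <| le_iSup_of_le c <| le_iSup_of_le d <| le_iSup_of_le h le_rfl
  calc sumVar φ f c d ≤ ∑ k, ∑ _j : Fin N, boxPhi φ f (c k) (d k) :=
        Finset.sum_le_sum fun k _ => Finset.sum_le_sum fun j _ => secVar_le_boxPhi φ f _ _ j
    _ = N * ∑ k, boxPhi φ f (c k) (d k) := by simp [Finset.mul_sum]
    _ ≤ N * totalVar φ f := by gcongr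

theorem sumVar_dilation_sub_le {N : ℕ} {φ : ℝ → ℝ} (hφ : IsPhiFun φ) {f : (Fin N → ℝ) → ℝ}
    (hf : Measurable f) {ν l : ℝ} (hν : 0 ≤ ν) (hνl : 2 * ν ≤ l) {t : Fin N → ℝ}
    (ht : t ∈ RPos N) {a b : Fin N → ℝ} (ha : ∀ i, 0 < a i) (hab : ∀ i, a i ≤ b i) {m : ℕ}
    {c d : Fin m → Fin N → ℝ} (h : IsBoxPartition a b c d) :
    sumVar φ (fun x => ν * (f (x * t) - f x)) c d ≤
      N * totalVar φ (fun x => l * f x) + N * totalVar φ (fun x => l * f x) := by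
  have hscale : ∀ x y : ℝ, φ |2 * (ν * x) - 2 * (ν * y)| ≤ φ |l * x - l * y| := fun x y => by
    rw [← mul_assoc, ← mul_assoc, ← mul_sub, ← mul_sub]
    exact hφ.abs_mul_le (by positivity) hνl _
  have hat : ∀ i, 0 < (a * t) i := fun i => mul_pos (ha i) (ht i)
  refine le_trans ?_ (add_le_add
    (sumVar_le_mul_totalVar φ _ hat (fun i => mul_le_mul_of_nonneg_right (hab i) (ht i).le)
      (h.mul ht))
    (sumVar_le_mul_totalVar φ _ ha hab h))
  unfold sumVar
  simp_rw [← Finset.sum_add_distrib]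
  refine Finset.sum_le_sum fun k _ => Finset.sum_le_sum fun j _ => ?_
  simp_rw [mul_sub]
  refine (secVar_sub_le hφ ((hf.comp (measurable_mul_const t)).const_mul ν) _ _ _ j).trans ?_
  refine add_le_add (le_trans ?_ (secVar_comp_mul_le φ (fun x => l * f x) _ _ ht j)) ?_
  · exact secVar_mono (fun x _ y _ => hscale _ _) (h.pos ha k) j
  · exact secVar_mono (fun x _ y _ => hscale _ _) (h.pos ha k) j

theorem measurable_prodCoord {N : ℕ} : Measurable (prodCoord : (Fin N → ℝ) → ℝ) := by
  unfold prodCoord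
  fun_prop

theorem measurable_distOne {N : ℕ} : Measurable (distOne : (Fin N → ℝ) → ℝ) := by
  unfold distOne
  fun_prop

theorem measurable_logNorm {N : ℕ} : Measurable (logNorm : (Fin N → ℝ) → ℝ) := by
  unfold logNorm
  fun_prop

theorem measurableSet_RPos (N : ℕ) : MeasurableSet (RPos N) := by
  have : RPos N = Set.pi univ fun _ => Ioi 0 := by
    ext
    simp [RPos]
  rw [this]
  exact .univ_pi fun _ => measurableSet_Ioi

theorem prodCoord_pos {N : ℕ} {t : Fin N → ℝ} (ht : t ∈ RPos N) : 0 < prodCoord t :=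
  Finset.prod_pos fun i _ => ht i

theorem logNorm_le {N : ℕ} {t : Fin N → ℝ} (ht : t ∈ RPos N) {δ : ℝ} (hδ : δ < 1)
    (h : distOne t ≤ δ) : logNorm t ≤ Real.sqrt (∑ _i : Fin N, ((1 - δ)⁻¹) ^ 2) := by
  refine Real.sqrt_le_sqrt (Finset.sum_le_sum fun i _ => ?_)
  have hi : |1 - t i| ≤ δ := by
    refine le_trans ?_ h
    rw [← Real.sqrt_sq_eq_abs]
    exact Real.sqrt_le_sqrt (Finset.single_le_sum (f := fun i => (1 - t i) ^ 2)
      (fun _ _ => sq_nonneg _) (Finset.mem_univ i))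
  rw [abs_le] at hi
  have h1δ : 0 < 1 - δ := by linarith
  have hinv : 1 ≤ (1 - δ)⁻¹ := (one_le_inv₀ h1δ).2 (by linarith)
  have hti : (t i)⁻¹ ≤ (1 - δ)⁻¹ := inv_anti₀ h1δ (by linarith)
  have hlow := Real.one_sub_inv_le_log_of_pos (ht i)
  have hup := Real.log_le_sub_one_of_pos (ht i)
  exact sq_le_sq' (by linarith) (by linarith)

theorem setLIntegral_mul_logNorm_rpow {N : ℕ} {κ : (Fin N → ℝ) → ℝ} (hκ : Measurable κ)
    (hki : IntegrableOn (fun t => κ t * (prodCoord t)⁻¹) (RPos N)) {α : ℝ} (hα : 0 ≤ α) {δ : ℝ}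
    (hδ : δ < 1) :
    ∫⁻ t in {t ∈ RPos N | distOne t ≤ δ},
        ENNReal.ofReal (|κ t| * logNorm t ^ α * (prodCoord t)⁻¹) =
      ENNReal.ofReal (∫ t in {t ∈ RPos N | distOne t ≤ δ},
        |κ t| * logNorm t ^ α * (prodCoord t)⁻¹) := by
  have hS : MeasurableSet {t ∈ RPos N | distOne t ≤ δ} :=
    (measurableSet_RPos N).inter (measurable_distOne measurableSet_Iic)
  have hm1 : Measurable (logNorm : (Fin N → ℝ) → ℝ) := measurable_logNorm
  have hm2 : Measurable (prodCoord : (Fin N → ℝ) → ℝ) := measurable_prodCoord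
  have hnn : ∀ t ∈ RPos N, 0 ≤ |κ t| * logNorm t ^ α * (prodCoord t)⁻¹ := fun t ht => by
    have := (prodCoord_pos ht).le
    have := Real.rpow_nonneg (Real.sqrt_nonneg _ : 0 ≤ logNorm t) α
    positivity
  refine (ofReal_integral_eq_lintegral_ofReal ?_
    ((ae_restrict_iff' hS).2 (ae_of_all _ fun t ht => hnn t ht.1))).symm
  have hb : IntegrableOn (fun t => Real.sqrt (∑ _i : Fin N, ((1 - δ)⁻¹) ^ 2) ^ α *
      |κ t * (prodCoord t)⁻¹|) {t ∈ RPos N | distOne t ≤ δ} :=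
    (hki.mono_set (sep_subset _ _)).abs.const_mul _
  refine Integrable.mono' hb (by fun_prop) ((ae_restrict_iff' hS).2 (ae_of_all _ fun t ht => ?_))
  have hp := prodCoord_pos ht.1
  rw [Real.norm_of_nonneg (hnn t ht.1), abs_mul, abs_of_pos (inv_pos.2 hp)]
  have hlog := Real.rpow_le_rpow (Real.sqrt_nonneg _ : 0 ≤ logNorm t) (logNorm_le ht.1 hδ ht.2) hα
  calc |κ t| * logNorm t ^ α * (prodCoord t)⁻¹
      = logNorm t ^ α * (|κ t| * (prodCoord t)⁻¹) := by ring
    _ ≤ _ := mul_le_mul_of_nonneg_right hlog (mul_nonneg (abs_nonneg _) (inv_pos.2 hp).le)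

theorem setLIntegral_mul_inv_prodCoord {N : ℕ} {κ : (Fin N → ℝ) → ℝ}
    (hki : IntegrableOn (fun t => κ t * (prodCoord t)⁻¹) (RPos N)) (δ : ℝ) :
    ∫⁻ t in {t ∈ RPos N | δ < distOne t}, ENNReal.ofReal (|κ t| * (prodCoord t)⁻¹) =
      ENNReal.ofReal (∫ t in {t ∈ RPos N | δ < distOne t}, |κ t| * (prodCoord t)⁻¹) := by
  have hS : MeasurableSet {t ∈ RPos N | δ < distOne t} :=
    (measurableSet_RPos N).inter (measurable_distOne measurableSet_Ioi)
  refine (ofReal_integral_eq_lintegral_ofReal ?_ ((ae_restrict_iff' hS).2 (ae_of_all _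
    fun t ht => mul_nonneg (abs_nonneg _) (inv_pos.2 (prodCoord_pos ht.1)).le))).symm
  refine IntegrableOn.congr_fun (hki.mono_set (sep_subset _ _)).abs (fun t ht => ?_) hS
  simp only [abs_mul, abs_of_pos (inv_pos.2 (prodCoord_pos ht.1))]

theorem sumVar_mellinOp_sub_le {N : ℕ} {φ : ℝ → ℝ} (hφ : IsPhiFun φ) {κ f : (Fin N → ℝ) → ℝ}
    {A : ℝ} (hA : 0 < A) (hκ : Measurable κ)
    (hki : IntegrableOn (fun t => κ t * (prodCoord t)⁻¹) (RPos N))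
    (hκA : ∫ t in RPos N, |κ t| * (prodCoord t)⁻¹ ≤ A)
    (hκ1 : ∫ t in RPos N, κ t * (prodCoord t)⁻¹ = 1) (hf : Measurable f)
    (hdom : ∀ s ∈ RPos N, IntegrableOn (fun t => κ t * f (s * t) * (prodCoord t)⁻¹) (RPos N))
    (ν : ℝ) {a b : Fin N → ℝ} (ha : ∀ i, 0 < a i) {m : ℕ} {c d : Fin m → Fin N → ℝ}
    (h : IsBoxPartition a b c d) :
    sumVar φ (fun s => ν / A * (mellinOp κ f s - f s)) c d ≤
      ∫⁻ t in RPos N, ENNReal.ofReal (|κ t| * (prodCoord t)⁻¹) *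
        sumVar φ (fun x => ν * (f (x * t) - f x)) c d := by
  have habs : ∀ t ∈ RPos N, |κ t * (prodCoord t)⁻¹| = |κ t| * (prodCoord t)⁻¹ := fun t ht => by
    rw [abs_mul, abs_of_pos (inv_pos.2 (prodCoord_pos ht))]
  have habs' : ∫ t in RPos N, |κ t * (prodCoord t)⁻¹| =
      ∫ t in RPos N, |κ t| * (prodCoord t)⁻¹ :=
    setIntegral_congr_fun (measurableSet_RPos N) habs
  have hk : Measurable fun t => κ t * (prodCoord t)⁻¹ := hκ.mul measurable_prodCoord.inv
  have h1 : 1 ≤ ∫ t in RPos N, |κ t * (prodCoord t)⁻¹| := by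
    rw [← hκ1]
    exact (le_abs_self _).trans abs_integral_le_integral_abs
  have hkf : ∀ s ∈ RPos N, IntegrableOn (fun t => κ t * (prodCoord t)⁻¹ * f (s * t)) (RPos N) :=
    fun s hs => (hdom s hs).congr (ae_of_all _ fun t => by ring)
  have hH : ∀ s ∈ RPos N, ν / A * (mellinOp κ f s - f s) =
      ∫ t in RPos N, κ t * (prodCoord t)⁻¹ * (ν / A * (f (s * t) - f s)) := fun s hs => by
    have hsplit : ∀ t, κ t * (prodCoord t)⁻¹ * (ν / A * (f (s * t) - f s)) =
        ν / A * (κ t * f (s * t) * (prodCoord t)⁻¹ - κ t * (prodCoord t)⁻¹ * f s) :=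
      fun t => by ring
    simp_rw [hsplit]
    rw [integral_const_mul, integral_sub (hdom s hs) (hki.mul_const _), integral_mul_const, hκ1,
      one_mul, mellinOp]
  have hsec : ∀ k j, secVar φ (fun s => ν / A * (mellinOp κ f s - f s)) (c k) (d k) j ≤
      ∫⁻ t in RPos N, ENNReal.ofReal |κ t * (prodCoord t)⁻¹| *
        secVar φ (fun x => ν * (f (x * t) - f x)) (c k) (d k) j := fun k j => by
    have := secVar_integral_le hφ hk hf hki h1 (habs'.trans_le hκA) hkf hH (b := d k)
      (h.pos ha k) j
    simpa only [← mul_assoc, mul_div_cancel₀ ν hA.ne'] using this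
  calc sumVar φ (fun s => ν / A * (mellinOp κ f s - f s)) c d
      ≤ ∑ k, ∑ j, ∫⁻ t in RPos N, ENNReal.ofReal |κ t * (prodCoord t)⁻¹| *
          secVar φ (fun x => ν * (f (x * t) - f x)) (c k) (d k) j :=
        Finset.sum_le_sum fun k _ => Finset.sum_le_sum fun j _ => hsec k j
    _ ≤ ∫⁻ t in RPos N, ∑ k, ∑ j, ENNReal.ofReal |κ t * (prodCoord t)⁻¹| *
          secVar φ (fun x => ν * (f (x * t) - f x)) (c k) (d k) j :=
        (Finset.sum_le_sum fun k _ => Finset.sum_lintegral_le _ _).trans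
          (Finset.sum_lintegral_le _ _)
    _ ≤ _ := by
        refine setLIntegral_mono' (measurableSet_RPos N) fun t ht => ?_
        rw [habs t ht]
        simp_rw [sumVar, Finset.mul_sum]
        exact le_rfl

/-- order of approximation: if `{K_w}` satisfies `(K_w.1)`, `(K_w.2)`,
is `α`-singular and `∫_{|1−t|≤δ̃} |K_w(t)| |log t|^α ⟨t⟩⁻¹ dt = O(w^{−α})` for some
`δ̃ ∈ (0,1)`, then for every `f ∈ V^φ Lip_N(α)` in the domain of the operators there
exists `λ > 0` with `V^φ[λ(T_w f − f)] = O(w^{−α})` for sufficiently large `w`. -/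
theorem statement5 {N : ℕ} (hN : 1 ≤ N) (φ : ℝ → ℝ) (hφ : IsPhiFun φ) (α : ℝ)
    (hα : 0 < α) (K : ℝ → (Fin N → ℝ) → ℝ) (A : ℝ) (hA : 0 < A)
    (hK1 : KernelCond1 K A) (hK2 : KernelCond2 K) (hsing : AlphaSingular K α)
    (hmom : ∃ δt : ℝ, 0 < δt ∧ δt < 1 ∧
      (fun w => ∫ t in {t ∈ RPos N | distOne t ≤ δt},
          |K w t| * logNorm t ^ α * (prodCoord t)⁻¹)
        =O[atTop] fun w : ℝ => w ^ (-α))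
    (f : (Fin N → ℝ) → ℝ) (hf : MemLipAlpha φ α f) (hdom : InDomain K f) :
    ∃ l > (0 : ℝ), ∃ C > (0 : ℝ), ∃ w₀ > (0 : ℝ), ∀ w ≥ w₀,
      totalVar φ (fun s => l * (mellinOp (K w) f s - f s)) ≤
        ENNReal.ofReal (C * w ^ (-α)) := by
  obtain ⟨⟨hfm, l₀, hl₀, hBV⟩, μ, hμ, C, hC, η, hη, hLip⟩ := hf
  obtain ⟨δt, hδt0, hδt1, hmom⟩ := hmom
  set δ := min η δt with hδ
  have hδ0 : 0 < δ := lt_min hη hδt0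
  have hδ1 : δ < 1 := (min_le_right _ _).trans_lt hδt1
  obtain ⟨D₁, hD₁, hb₁⟩ := hmom.exists_pos
  obtain ⟨D₂, hD₂, hb₂⟩ := (hsing δ hδ0 hδ1).exists_pos
  set ν := min μ (l₀ / 2) with hν
  have hν0 : 0 < ν := lt_min hμ (half_pos hl₀)
  have hνl : 2 * ν ≤ l₀ := by linarith [min_le_right μ (l₀ / 2)]
  set V := totalVar φ (fun x => l₀ * f x) with hV
  set B : ℝ≥0∞ := N * V + N * V with hB
  have hBtop : B ≠ ⊤ := by
    have := ENNReal.mul_ne_top (ENNReal.natCast_ne_top N) hBV.ne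
    exact ENNReal.add_ne_top.2 ⟨this, this⟩
  obtain ⟨w₁, hw₁⟩ := eventually_atTop.1 (hb₁.bound.and hb₂.bound)
  refine ⟨ν / A, div_pos hν0 hA, N * C * D₁ + B.toReal * D₂ + 1, by positivity, max w₁ 1,
    by positivity, fun w hw => totalVar_le_of_sumVar_le fun a b ha hab m c d hcd => ?_⟩
  have hw0 : 0 < w := one_pos.trans_le ((le_max_right _ _).trans hw)
  obtain ⟨hbd₁, hbd₂⟩ := hw₁ w ((le_max_left _ _).trans hw)
  have hwα : 0 < w ^ (-α) := Real.rpow_pos_of_pos hw0 _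
  rw [Real.norm_of_nonneg hwα.le] at hbd₁ hbd₂
  obtain ⟨hKm, hKi, hKA, hK⟩ := hK1 w hw0
  refine (sumVar_mellinOp_sub_le hφ hA hKm hKi hKA hK hfm (hdom w hw0) ν ha hcd).trans ?_
  have hS : MeasurableSet {t : Fin N → ℝ | distOne t ≤ δ} := measurable_distOne measurableSet_Iic
  have hnear : ({t : Fin N → ℝ | distOne t ≤ δ} ∩ RPos N) = {t ∈ RPos N | distOne t ≤ δ} :=
    inter_comm _ _
  have hfar : ({t : Fin N → ℝ | distOne t ≤ δ}ᶜ ∩ RPos N) = {t ∈ RPos N | δ < distOne t} := by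
    ext t
    simp [and_comm]
  rw [← lintegral_add_compl _ hS, Measure.restrict_restrict hS,
    Measure.restrict_restrict hS.compl, hnear, hfar]
  have hN0 : (0 : ℝ) ≤ N := Nat.cast_nonneg N
  have h₁ : ∫⁻ t in {t ∈ RPos N | distOne t ≤ δ}, ENNReal.ofReal (|K w t| * (prodCoord t)⁻¹) *
      sumVar φ (fun x => ν * (f (x * t) - f x)) c d ≤
      ENNReal.ofReal (N * C * D₁ * w ^ (-α)) := by
    calc _ ≤ ∫⁻ t in {t ∈ RPos N | distOne t ≤ δ}, ENNReal.ofReal (N * C) *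
            ENNReal.ofReal (|K w t| * logNorm t ^ α * (prodCoord t)⁻¹) := by
          refine setLIntegral_mono' ((measurableSet_RPos N).inter hS) fun t ht => ?_
          have hvar : sumVar φ (fun x => ν * (f (x * t) - f x)) c d ≤
              N * ENNReal.ofReal (C * logNorm t ^ α) :=
            calc sumVar φ (fun x => ν * (f (x * t) - f x)) c d
                ≤ sumVar φ (fun x => μ * (f (x * t) - f x)) c d := by
                  refine Finset.sum_le_sum fun k _ => Finset.sum_le_sum fun j _ =>
                    secVar_mono (fun x _ y _ => ?_) (hcd.pos ha k) j
                  rw [← mul_sub, ← mul_sub]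
                  exact hφ.abs_mul_le hν0.le (min_le_left _ _) _
              _ ≤ N * totalVar φ (fun x => μ * (f (x * t) - f x)) :=
                  sumVar_le_mul_totalVar φ _ ha hab hcd
              _ ≤ _ := by
                  gcongr
                  exact hLip t ht.1 (ht.2.trans (min_le_left _ _))
          refine (mul_le_mul' le_rfl hvar).trans_eq ?_
          have hp := (inv_pos.2 (prodCoord_pos ht.1)).le
          rw [← ENNReal.ofReal_natCast, ← ENNReal.ofReal_mul hN0, ← ENNReal.ofReal_mul
            (mul_nonneg (abs_nonneg _) hp), ← ENNReal.ofReal_mul (by positivity)]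
          congr 1
          ring
      _ ≤ ∫⁻ t in {t ∈ RPos N | distOne t ≤ δt}, ENNReal.ofReal (N * C) *
            ENNReal.ofReal (|K w t| * logNorm t ^ α * (prodCoord t)⁻¹) :=
          lintegral_mono_set fun t ht => ⟨ht.1, ht.2.trans (min_le_right _ _)⟩
      _ ≤ _ := by
          rw [lintegral_const_mul' _ _ ENNReal.ofReal_ne_top,
            setLIntegral_mul_logNorm_rpow hKm hKi hα.le hδt1,
            ← ENNReal.ofReal_mul (by positivity)]
          refine ENNReal.ofReal_le_ofReal ?_
          rw [mul_assoc _ D₁]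
          gcongr
          exact (Real.le_norm_self _).trans hbd₁
  have h₂ : ∫⁻ t in {t ∈ RPos N | δ < distOne t}, ENNReal.ofReal (|K w t| * (prodCoord t)⁻¹) *
      sumVar φ (fun x => ν * (f (x * t) - f x)) c d ≤
      ENNReal.ofReal (B.toReal * D₂ * w ^ (-α)) := by
    calc _ ≤ ∫⁻ t in {t ∈ RPos N | δ < distOne t},
            ENNReal.ofReal (|K w t| * (prodCoord t)⁻¹) * B := by
          refine setLIntegral_mono' ((measurableSet_RPos N).inter
            (measurable_distOne measurableSet_Ioi)) fun t ht => ?_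
          gcongr
          exact sumVar_dilation_sub_le hφ hfm hν0.le hνl ht.1 ha hab hcd
      _ ≤ _ := by
          rw [lintegral_mul_const' _ _ hBtop, setLIntegral_mul_inv_prodCoord hKi,
            ← ENNReal.ofReal_toReal hBtop, mul_comm, ← ENNReal.ofReal_mul (by positivity),
            ENNReal.toReal_ofReal (by positivity)]
          refine ENNReal.ofReal_le_ofReal ?_
          rw [mul_assoc]
          gcongr
          exact (Real.le_norm_self _).trans hbd₂
  refine (add_le_add h₁ h₂).trans ?_
  rw [← ENNReal.ofReal_add (by positivity) (by positivity)]
  refine ENNReal.ofReal_le_ofReal ?_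
  linarith

end
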